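/- Let n, k be natural numbers with 2 ≤ k ≤ n, and let α₁, αₖ be positive real numbers with αₖ > n/(n+1) and (k−1)/α₁ + (n−k+1)/αₖ < n+1. Let Φ be a set of triples (S, E, I) of real numbers such that: (i) for all (S, E, I) ∈ Φ, E + (n−k+1)·I ≤ n·S; (ii) for every real β₁ with β₁ ≥ 0 and β₁ > (1−α₁)/α₁ there exists a real C₁ such that S ≤ β₁·E + C₁ for all (S, E, I) ∈ Φ; (iii) for every real βₖ with (1−αₖ)/αₖ < βₖ < 1/n and every real Λ > 1 there exists a real C₂ such that S ≤ βₖ·E + Λ·I + C₂ for all (S, E, I) ∈ Φ. Then there exists a real constant C such that S ≤ C for all (S, E, I) ∈ Φ. -/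

import Mathlib

/-- If the lower bounds dictated by two alpha-invariants satisfy the strict numerical criterion,
they can be replaced by strictly larger slopes still satisfying it. -/
theorem exists_exponents_of_crit {n k α₁ αk : ℝ} (hk : 2 ≤ k) (hkn : k ≤ n)
    (hα₁ : 0 < α₁) (hαk : 0 < αk) (hαk_big : n / (n + 1) < αk)
    (hcrit : (k - 1) / α₁ + (n - k + 1) / αk < n + 1) :
    ∃ β₁ βk : ℝ, 0 < β₁ ∧ (1 - α₁) / α₁ < β₁ ∧ (1 - αk) / αk < βk ∧ βk < 1 / n ∧
      (k - 1) * β₁ + (n - k + 1) * βk < 1 := by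
  have hn : 0 < n := by linarith
  have hd : 0 < k - 1 := by linarith
  have hm : 0 < n - k + 1 := by linarith
  have hbn : (1 - αk) / αk < 1 / n := by
    rw [div_lt_iff₀ (by linarith)] at hαk_big
    rw [div_lt_div_iff₀ hαk hn]
    linarith
  have hmn : (n - k + 1) * ((1 - αk) / αk) < 1 := by
    have h := mul_lt_mul_of_pos_left hbn hm
    have h' : (n - k + 1) * (1 / n) < 1 := by
      rw [mul_one_div, div_lt_one hn]
      linarith
    linarith
  have hcrit' : (k - 1) * ((1 - α₁) / α₁) + (n - k + 1) * ((1 - αk) / αk) < 1 := by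
    have h : (k - 1) * ((1 - α₁) / α₁) + (n - k + 1) * ((1 - αk) / αk) =
        (k - 1) / α₁ + (n - k + 1) / αk - n := by
      field_simp
      ring
    linarith
  have hmax : (k - 1) * max 0 ((1 - α₁) / α₁) + (n - k + 1) * ((1 - αk) / αk) < 1 := by
    rcases max_choice 0 ((1 - α₁) / α₁) with h | h <;> rw [h] <;> linarith
  obtain ⟨βk, hβk, hβk'⟩ := exists_between (lt_min hbn
    ((lt_div_iff₀' hm).mpr (lt_sub_iff_add_lt'.mpr hmax)))
  obtain ⟨hβkn, hβkd⟩ := lt_min_iff.mp hβk'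
  rw [lt_div_iff₀' hm] at hβkd
  obtain ⟨β₁, hβ₁, hβ₁'⟩ := exists_between
    ((lt_div_iff₀' hd).mpr (lt_sub_comm.mp hβkd))
  rw [lt_div_iff₀' hd] at hβ₁'
  obtain ⟨h0, h1⟩ := max_lt_iff.mp hβ₁
  exact ⟨β₁, βk, h0, h1, hβk, hβkn, by linarith⟩

/-- Three linear inequalities between `S`, `E` and `I` whose slopes are compatible
bound `S` from above. -/
theorem bddAbove_of_energy_bounds {n m β₁ βk Λ C₁ C₂ : ℝ} {Φ : Set (ℝ × ℝ × ℝ)}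
    (hm : 0 ≤ m) (hΛ : 0 < Λ) (hβ₁ : 0 ≤ β₁) (hc : 0 < Λ - m * βk)
    (hslope : β₁ * (Λ * n - m) < Λ - m * βk)
    (hC : ∀ S E I : ℝ, (S, E, I) ∈ Φ → E + m * I ≤ n * S)
    (hA : ∀ S E I : ℝ, (S, E, I) ∈ Φ → S ≤ β₁ * E + C₁)
    (hB : ∀ S E I : ℝ, (S, E, I) ∈ Φ → S ≤ βk * E + Λ * I + C₂) :
    ∃ C : ℝ, ∀ S E I : ℝ, (S, E, I) ∈ Φ → S ≤ C := by
  refine ⟨(β₁ * (m * C₂) + (Λ - m * βk) * C₁) / (Λ - m * βk - β₁ * (Λ * n - m)),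
    fun S E I h => ?_⟩
  rw [le_div_iff₀ (sub_pos.mpr hslope)]
  have hE : (Λ - m * βk) * E ≤ (Λ * n - m) * S + m * C₂ := by
    linarith [mul_le_mul_of_nonneg_left (hC S E I h) hΛ.le,
      mul_le_mul_of_nonneg_left (hB S E I h) hm]
  linarith [mul_le_mul_of_nonneg_left hE hβ₁, mul_le_mul_of_nonneg_left (hA S E I h) hc.le]

/-- Abstract real-variable formulation of the C⁰-estimate (Theorem 5.3): a family of
triples (S, E, I) satisfying the Aubin-functional inequality and the two families of
algebraic-approximation estimates admits a uniform bound on S. -/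
theorem stmt_8 (n k : ℕ) (hk : 2 ≤ k) (hkn : k ≤ n)
    (α₁ αk : ℝ) (hα₁ : 0 < α₁) (hαk : 0 < αk)
    (hαk_big : (n : ℝ) / (n + 1) < αk)
    (hcrit : ((k : ℝ) - 1) / α₁ + ((n : ℝ) - k + 1) / αk < (n : ℝ) + 1)
    (Φ : Set (ℝ × ℝ × ℝ))
    (hC : ∀ S E I : ℝ, (S, E, I) ∈ Φ → E + ((n : ℝ) - k + 1) * I ≤ n * S)
    (hA : ∀ β₁ : ℝ, 0 ≤ β₁ → (1 - α₁) / α₁ < β₁ →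
      ∃ C₁ : ℝ, ∀ S E I : ℝ, (S, E, I) ∈ Φ → S ≤ β₁ * E + C₁)
    (hB : ∀ βk : ℝ, (1 - αk) / αk < βk → βk < 1 / n → ∀ Λ : ℝ, 1 < Λ →
      ∃ C₂ : ℝ, ∀ S E I : ℝ, (S, E, I) ∈ Φ → S ≤ βk * E + Λ * I + C₂) :
    ∃ C : ℝ, ∀ S E I : ℝ, (S, E, I) ∈ Φ → S ≤ C := by
  have hk' : (2 : ℝ) ≤ k := by exact_mod_cast hk
  have hkn' : (k : ℝ) ≤ n := by exact_mod_cast hkn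
  obtain ⟨β₁, βk, hβ₁, hβ₁', hβk, hβk', hsum⟩ :=
    exists_exponents_of_crit hk' hkn' hα₁ hαk hαk_big hcrit
  set m : ℝ := (n : ℝ) - k + 1 with hm
  have hm0 : 0 < m := by linarith
  have hn0 : (0 : ℝ) < n := by linarith
  have hd : 0 < ((k : ℝ) - 1) * β₁ := mul_pos (by linarith) hβ₁
  obtain ⟨δ, hδ, hδ'⟩ : ∃ δ : ℝ, 0 < δ ∧ δ * (n * β₁) < 1 - (((k : ℝ) - 1) * β₁ + m * βk) := by
    obtain ⟨δ, hδ, hδ'⟩ := exists_between (div_pos (sub_pos.mpr hsum) (mul_pos hn0 hβ₁))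
    exact ⟨δ, hδ, (lt_div_iff₀ (mul_pos hn0 hβ₁)).mp hδ'⟩
  obtain ⟨C₁, hC₁⟩ := hA β₁ hβ₁.le hβ₁'
  obtain ⟨C₂, hC₂⟩ := hB βk hβk hβk' (1 + δ) (by linarith)
  refine bddAbove_of_energy_bounds hm0.le (by linarith : 0 < 1 + δ) hβ₁.le
    (by linarith : 0 < 1 + δ - m * βk) ?_ hC hC₁ hC₂
  have hkm : (k : ℝ) = n - m + 1 := by linarith
  rw [hkm] at hδ'
  linarith
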